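/- Let k be an algebraically closed field, and let ρ: H → GL_5(k) be a representation of a group H such that for every h ∈ H, ρ(h) restricted to... Suppose D: H → GL_5(k) is a homomorphism landing in diagonal matrices, and g is the cyclic coordinate permutation of order 5 normalizing D(H) by D(h) ↦ g D(h) g^{-1} (cyclic shift of diagonal entries). Assume that for every h ∈ H, the diagonal matrix D(h) has the property that each of its diagonal entries, counted as eigenvalues, has multiplicity at least 2 would force... Prove: if for all h ∈ H and all i ∈ {1,2,3,4}, the product D(h) · g^i D(h) g^{-i} has the eigenvalue-multiplicity-≥-2 property for the entry equal to (first entry)^2, and the first two entries of D(h) equal 1, then all entries of D(h) equal 1 for all h, i.e., D is trivial. -/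

import Mathlib

/-- A value attained at least twice, once at `j`, is attained at some other index. -/
theorem exists_ne_eq_of_two_le_card {ι α : Type*} {f : ι → α} {j : ι}
    (h : 2 ≤ Nat.card {j' : ι // f j' = f j}) : ∃ j', j' ≠ j ∧ f j' = f j := by
  have : Finite {j' : ι // f j' = f j} := Nat.finite_of_card_ne_zero (by omega)
  have : Nontrivial {j' : ι // f j' = f j} := Finite.one_lt_card_iff_nontrivial.mp h
  obtain ⟨⟨j', hj'⟩, hne⟩ := exists_ne (⟨j, rfl⟩ : {j' : ι // f j' = f j})
  exact ⟨j', fun h => hne (Subtype.ext h), hj'⟩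

/-- A vector `(1, 1, a, b, c)` in a commutative group each of whose entries is repeated, and whose
products with its nontrivial cyclic shifts have the same property, is constant. -/
theorem eq_one_of_forall_exists_ne_eq {G : Type*} [CommGroup G] (f : Fin 5 → G)
    (h0 : f 0 = 1) (h1 : f 1 = 1) (hf : ∀ j, ∃ j', j' ≠ j ∧ f j' = f j)
    (hshift : ∀ i : Fin 5, i ≠ 0 → ∀ j, ∃ j', j' ≠ j ∧ f j' * f (j' + i) = f j * f (j + i)) :
    ∀ j, f j = 1 := by
  have exists_fin_five (P : Fin 5 → Prop) : (∃ j, P j) ↔ P 0 ∨ P 1 ∨ P 2 ∨ P 3 ∨ P 4 := by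
    simp [Fin.exists_fin_succ]
  have e₂ := hf 2
  have e₃ := hf 3
  have e₄ := hf 4
  have s₁ := hshift 1 (by decide) 0
  have s₂ := hshift 2 (by decide) 0
  have s₃ := hshift 2 (by decide) 2
  have s₄ := hshift 2 (by decide) 4
  clear hf hshift
  rw [exists_fin_five] at e₂ e₃ e₄ s₁ s₂ s₃ s₄
  simp [h0, h1] at e₂ e₃ e₄ s₁ s₂ s₃ s₄
  suffices f 2 = 1 ∧ f 3 = 1 ∧ f 4 = 1 by
    simp [Fin.forall_fin_succ, h0, h1, this]
  generalize f 2 = a at *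
  generalize f 3 = b at *
  generalize f 4 = c at *
  obtain ⟨rfl, rfl⟩ | ⟨rfl, rfl⟩ | ⟨rfl, rfl⟩ | ⟨rfl, rfl⟩ :
      (a = b ∧ b = c) ∨ (a = 1 ∧ b = c) ∨ (b = 1 ∧ a = c) ∨ (c = 1 ∧ a = b) := by grind
  all_goals simp_all

/-- Let `D : H → (kˣ)^5` be a homomorphism of a group `H` into the diagonal torus of
`GL_5(k)` (`k` algebraically closed), normalized by the cyclic coordinate shift `g` of order
`5`. Suppose that for every `h ∈ H` the first two diagonal entries of `D h` equal `1`, that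
every diagonal entry of `D h` occurs with multiplicity at least `2` among the five entries,
and that the same multiplicity-`≥ 2` property holds for each product `D h · g^i (D h) g^{-i}`
(`i = 1, 2, 3, 4`, acting by cyclically shifting the entries). Then every entry of every `D h`
equals `1`, i.e. `D` is trivial. -/
theorem diagonal_multiplicity_two_trivial {k H : Type*} [Field k] [IsAlgClosed k] [Group H]
    (D : H →* (Fin 5 → kˣ))
    (hone : ∀ h : H, D h 0 = 1 ∧ D h 1 = 1)
    (hmult : ∀ (h : H) (j : Fin 5), 2 ≤ Nat.card {j' : Fin 5 // D h j' = D h j})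
    (hprod : ∀ (h : H) (i : Fin 5), i ≠ 0 → ∀ j : Fin 5,
      2 ≤ Nat.card {j' : Fin 5 // D h j' * D h (j' + i) = D h j * D h (j + i)}) :
    ∀ (h : H) (j : Fin 5), D h j = 1 := by
  intro h
  exact eq_one_of_forall_exists_ne_eq (D h) (hone h).1 (hone h).2
    (fun j => exists_ne_eq_of_two_le_card (hmult h j))
    (fun i hi j => exists_ne_eq_of_two_le_card (f := fun j => D h j * D h (j + i)) (hprod h i hi j))
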